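/- Let m ≥ 57 and let G* attain the maximum spectral radius among all θ_{2,2,3}-free graphs with m edges and no isolated vertices. Let x be a positive eigenvector of the adjacency matrix of G* corresponding to λ(G*), let u* be a vertex maximizing the entries of x, and set U = N(u*). Then for every k ≥ 4, no connected component of the induced subgraph G*[U] is isomorphic to the path P_k. -/

import Mathlib

open SimpleGraph

/-- `F` is contained in `G` as a (not necessarily induced) subgraph. -/
def Contains {α β : Type*} (F : SimpleGraph α) (G : SimpleGraph β) : Prop :=
  ∃ f : α ↪ β, ∀ ⦃a b⦄, F.Adj a b → G.Adj (f a) (f b)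

/-- The theta graph θ_{2,2,3}: vertices 0 = a, 1 = b, 2 = c₁, 3 = c₂, 4 = d₁, 5 = d₂,
with edges ac₁, c₁b, ac₂, c₂b, ad₁, d₁d₂, d₂b. -/
def theta223 : SimpleGraph (Fin 6) :=
  SimpleGraph.fromRel (fun x y =>
    (x = 0 ∧ y = 2) ∨ (x = 2 ∧ y = 1) ∨ (x = 0 ∧ y = 3) ∨ (x = 3 ∧ y = 1) ∨
    (x = 0 ∧ y = 4) ∨ (x = 4 ∧ y = 5) ∨ (x = 5 ∧ y = 1))

open Classical in
/-- The real adjacency matrix of a simple graph. -/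
noncomputable def adjMat {V : Type*} (G : SimpleGraph V) : Matrix V V ℝ :=
  Matrix.of fun a b => if G.Adj a b then 1 else 0

/-- `lam` is the largest eigenvalue (spectral radius) of the adjacency matrix of `G`. -/
def IsSpectralRadius {V : Type*} [Fintype V] (G : SimpleGraph V) (lam : ℝ) : Prop :=
  (∃ v : V → ℝ, v ≠ 0 ∧ (adjMat G).mulVec v = lam • v) ∧
  ∀ (μ : ℝ) (v : V → ℝ), v ≠ 0 → (adjMat G).mulVec v = μ • v → μ ≤ lam

/-- The join K₂ ∨ kK₁ : two adjacent dominating vertices joined to k pairwise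
nonadjacent vertices. -/
def K2JoinEmpty (k : ℕ) : SimpleGraph (Fin 2 ⊕ Fin k) :=
  SimpleGraph.fromRel (fun x _ => x.isLeft)

/-- The star K_{1,r} with center 0 and r leaves. -/
def starGraph (r : ℕ) : SimpleGraph (Fin (r + 1)) :=
  SimpleGraph.fromRel (fun x _ => x = 0)

/-- The double star S_{1,2}: central edge 01, leaf 2 adjacent to 0, leaves 3, 4 adjacent to 1. -/
def doubleStarS12 : SimpleGraph (Fin 5) :=
  SimpleGraph.fromRel (fun x y =>
    (x = 0 ∧ y = 1) ∨ (x = 0 ∧ y = 2) ∨ (x = 1 ∧ y = 3) ∨ (x = 1 ∧ y = 4))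

/-- K_{1,3}+e: the star with center 0 and leaves 1, 2, 3, plus the edge 12. -/
def K13e : SimpleGraph (Fin 4) :=
  SimpleGraph.fromRel (fun x y => x = 0 ∨ (x = 1 ∧ y = 2))

/-- K₄ − e: the complete graph on four vertices minus the edge 23. -/
def K4e : SimpleGraph (Fin 4) :=
  SimpleGraph.fromRel (fun x y => ¬(x = 2 ∧ y = 3) ∧ ¬(x = 3 ∧ y = 2))


section Helpers

open Finset

lemma adjMat_one {V : Type*} {G : SimpleGraph V} {a b : V} (h : G.Adj a b) :
    adjMat G a b = 1 := by simp [adjMat, h]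

lemma adjMat_zero {V : Type*} {G : SimpleGraph V} {a b : V} (h : ¬ G.Adj a b) :
    adjMat G a b = 0 := by simp [adjMat, h]

lemma adjMat_comm {V : Type*} (G : SimpleGraph V) (a b : V) :
    adjMat G a b = adjMat G b a := by
  by_cases h : G.Adj a b
  · rw [adjMat_one h, adjMat_one h.symm]
  · rw [adjMat_zero h, adjMat_zero (fun h' => h h'.symm)]

lemma adjMat_nonneg {V : Type*} (G : SimpleGraph V) (a b : V) : 0 ≤ adjMat G a b := by
  by_cases h : G.Adj a b
  · rw [adjMat_one h]; norm_num
  · rw [adjMat_zero h]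

lemma adjMat_sum {V : Type*} [Fintype V] (G : SimpleGraph V) :
    ∑ a, ∑ b, adjMat G a b = 2 * (G.edgeSet.ncard : ℝ) := by
  classical
  have h := G.sum_degrees_eq_twice_card_edges
  have h2 : G.edgeSet.ncard = #G.edgeFinset := by
    rw [← SimpleGraph.coe_edgeFinset, Set.ncard_coe_finset]
  rw [h2]
  have : ∀ a, ∑ b, adjMat G a b = (G.degree a : ℝ) := by
    intro a
    simp only [adjMat, Matrix.of_apply, Finset.sum_boole]
    rw [← SimpleGraph.card_neighborFinset_eq_degree]
    congr 2
    ext; simp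
  simp only [this]
  exact_mod_cast h

/-- A positive eigenvector belongs to the largest eigenvalue. -/
lemma isSpectralRadius_of_pos {V : Type*} [Fintype V] [Nonempty V] (G : SimpleGraph V)
    (mu : ℝ) (y : V → ℝ) (hy : ∀ v, 0 < y v)
    (h : ∀ a, ∑ b, adjMat G a b * y b = mu * y a) : IsSpectralRadius G mu := by
  refine ⟨⟨y, ?_, ?_⟩, ?_⟩
  · intro h0
    have := hy (Classical.arbitrary V)
    simp [h0] at this
  · ext a
    simpa [Matrix.mulVec, dotProduct] using h a
  · intro nu v hv hnu
    obtain ⟨i, hi⟩ := Finite.exists_max (fun i => |v i| / y i)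
    set t := |v i| / y i with ht
    have hvi : |v i| = t * y i := by rw [ht]; field_simp [(hy i).ne']
    have hle : ∀ j, |v j| ≤ t * y j := fun j => by
      have := hi j
      rwa [div_le_iff₀ (hy j)] at this
    have htpos : 0 < t := by
      obtain ⟨j, hj⟩ := Function.ne_iff.mp hv
      have h1 : 0 < |v j| := abs_pos.mpr hj
      exact lt_of_lt_of_le (div_pos h1 (hy j)) (hi j)
    have e1 : ∑ b, adjMat G i b * v b = nu * v i := by
      have := congrFun hnu i
      simpa [Matrix.mulVec, dotProduct] using this
    have e2 : nu * |v i| ≤ mu * |v i| := by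
      calc nu * |v i| ≤ |nu| * |v i| := by gcongr; exact le_abs_self _
        _ = |∑ b, adjMat G i b * v b| := by rw [e1, abs_mul]
        _ ≤ ∑ b, |adjMat G i b * v b| := Finset.abs_sum_le_sum_abs _ _
        _ ≤ ∑ b, t * (adjMat G i b * y b) := by
            apply Finset.sum_le_sum
            intro b _
            rw [abs_mul, abs_of_nonneg (adjMat_nonneg G i b)]
            have := mul_le_mul_of_nonneg_left (hle b) (adjMat_nonneg G i b)
            linarith
        _ = mu * |v i| := by rw [← Finset.mul_sum, h i, hvi]; ring
    have : 0 < |v i| := by rw [hvi]; exact mul_pos htpos (hy i)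
    exact le_of_mul_le_mul_right e2 this

/-- Two adjacent hubs, `k` common neighbours, `j` pendant vertices at the hub `true`. -/
def hubGraph (k j : ℕ) : SimpleGraph (Bool ⊕ (Fin k ⊕ Fin j)) :=
  SimpleGraph.fromRel (fun x y => match x, y with
    | .inl _, .inl _ => True
    | .inl _, .inr (.inl _) => True
    | .inl b, .inr (.inr _) => b = true
    | _, _ => False)

lemma hub_adj_hub (k j : ℕ) {p q : Bool ⊕ (Fin k ⊕ Fin j)} (h : (hubGraph k j).Adj p q) :
    (∃ b, p = .inl b) ∨ (∃ b, q = .inl b) := by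
  rcases p with p | p | p <;> rcases q with q | q | q <;> simp [hubGraph] at h ⊢

lemma hub_free (k j : ℕ) : ¬ Contains theta223 (hubGraph k j) := by
  rintro ⟨f, hf⟩
  have h1 := hub_adj_hub k j (hf (a := 0) (b := 2) (by simp [theta223]))
  have h2 := hub_adj_hub k j (hf (a := 1) (b := 3) (by simp [theta223]))
  have h3 := hub_adj_hub k j (hf (a := 4) (b := 5) (by simp [theta223]))
  have key : ∀ (a b c : Fin 6), a ≠ b → a ≠ c → b ≠ c → (∃ t, f a = .inl t) →
      (∃ t, f b = .inl t) → (∃ t, f c = .inl t) → False := by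
    rintro a b c hab hac hbc ⟨t, ht⟩ ⟨s, hs⟩ ⟨r, hr⟩
    have h1 : t ≠ s := fun h => hab (f.injective (by rw [ht, hs, h]))
    have h2 : t ≠ r := fun h => hac (f.injective (by rw [ht, hr, h]))
    have h3 : s ≠ r := fun h => hbc (f.injective (by rw [hs, hr, h]))
    revert h1 h2 h3
    cases t <;> cases s <;> cases r <;> simp
  rcases h1 with h1 | h1 <;> rcases h2 with h2 | h2 <;> rcases h3 with h3 | h3 <;>
    exact key _ _ _ (by decide) (by decide) (by decide) h1 h2 h3

lemma hub_noiso (k j : ℕ) : ∀ v, ∃ w, (hubGraph k j).Adj v w := by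
  rintro (b | b | b)
  · exact ⟨.inl !b, by cases b <;> simp [hubGraph]⟩
  · exact ⟨.inl true, by simp [hubGraph]⟩
  · exact ⟨.inl true, by simp [hubGraph]⟩

lemma hub_card (k j : ℕ) : (hubGraph k j).edgeSet.ncard = 2 * k + 1 + j := by
  have h := adjMat_sum (hubGraph k j)
  simp [Fintype.sum_sum_type, adjMat, hubGraph] at h
  have : (2 * (hubGraph k j).edgeSet.ncard : ℝ) = 2 * (2 * k + 1 + j) := by
    simp only [hubGraph]
    rw [← h]; ring
  have := mul_left_cancel₀ (by norm_num) this
  exact_mod_cast this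

lemma hub_spec (k j : ℕ) (hk : 1 ≤ k) (hj : j ≤ 1) :
    ∃ mu : ℝ, IsSpectralRadius (hubGraph k j) mu ∧ 0 < mu ∧
      (2 * k + 1 + j : ℝ) - 3 / 2 < mu ^ 2 - mu := by
  have hk' : (1 : ℝ) ≤ k := by exact_mod_cast hk
  set p : ℝ → ℝ := fun t => (t ^ 2 - k - j) * (t ^ 2 - k) - (t + k) ^ 2 with hp
  obtain ⟨l0, hl0, hl0pos⟩ : ∃ l0 : ℝ, l0 ^ 2 - l0 = 2 * k + j - 1 / 2 ∧ 1 < l0 := by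
    refine ⟨(1 + √(1 + 4 * (2 * k + j - 1 / 2))) / 2, ?_, ?_⟩
    · have := Real.sq_sqrt (show (0 : ℝ) ≤ 1 + 4 * (2 * k + j - 1 / 2) by
        have : (0 : ℝ) ≤ j := by positivity
        linarith)
      nlinarith
    · have : (1 : ℝ) < √(1 + 4 * (2 * k + j - 1 / 2)) := by
        rw [Real.lt_sqrt (by norm_num)]
        have : (0 : ℝ) ≤ j := by positivity
        linarith
      linarith
  have hj' : (j : ℝ) = 0 ∨ (j : ℝ) = 1 := by
    interval_cases j <;> simp
  have hp0 : p l0 < 0 := by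
    have e : l0 ^ 2 = l0 + 2 * k + j - 1 / 2 := by linarith
    simp only [hp]
    rw [e]
    rcases hj' with h | h <;> rw [h] <;> nlinarith
  obtain ⟨mu, hmu, hmu0⟩ : ∃ mu, l0 < mu ∧ p mu = 0 := by
    have hc : Continuous p := by simp only [hp]; fun_prop
    set L : ℝ := l0 + 2 * k + 10 with hL
    have hpL : 0 < p L := by
      simp only [hp]
      have h1 : L + k + 2 ≤ L ^ 2 - k - j := by
        rcases hj' with h | h <;> rw [h] <;> nlinarith
      have h2 : L + k + 2 ≤ L ^ 2 - k := by
        rcases hj' with h | h <;> rw [h] at h1 <;> nlinarith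
      have : (L + k + 2) * (L + k + 2) ≤ (L ^ 2 - k - j) * (L ^ 2 - k) :=
        mul_le_mul h1 h2 (by linarith) (by linarith)
      nlinarith
    have := intermediate_value_Ioo (a := l0) (b := L) (by linarith) hc.continuousOn
    obtain ⟨mu, h1, h2⟩ := this ⟨hp0, hpL⟩
    exact ⟨mu, h1.1, h2⟩
  have hmupos : 0 < mu := by linarith
  have hgap : (2 * k + j : ℝ) - 1 / 2 < mu ^ 2 - mu := by nlinarith
  refine ⟨mu, ?_, hmupos, by linarith⟩
  have hb : 0 < mu ^ 2 - k - j := by linarith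
  apply isSpectralRadius_of_pos _ _ (fun v => match v with
    | .inl true => mu + k
    | .inl false => mu ^ 2 - k - j
    | .inr (.inl _) => (mu + k + (mu ^ 2 - k - j)) / mu
    | .inr (.inr _) => (mu + k) / mu)
  · rintro ((_ | _) | _ | _)
    · exact hb
    · show 0 < mu + k; linarith
    · show 0 < (mu + k + (mu ^ 2 - k - j)) / mu; exact div_pos (by linarith) hmupos
    · show 0 < (mu + k) / mu; exact div_pos (by linarith) hmupos
  · simp only [hp] at hmu0
    rintro ((_ | _) | _ | _) <;>
      simp [Fintype.sum_sum_type, adjMat, hubGraph] <;> field_simp <;> nlinarith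

lemma transfer {T : Type} [Fintype T] (H : SimpleGraph T) (m : ℕ) (lam : ℝ)
    (hmax : ∀ (n : ℕ) (H : SimpleGraph (Fin n)) (μ : ℝ),
      H.edgeSet.ncard = m → ¬ Contains theta223 H → (∀ v, ∃ w, H.Adj v w) →
      IsSpectralRadius H μ → μ ≤ lam) (mu : ℝ)
    (h1 : H.edgeSet.ncard = m) (h2 : ¬ Contains theta223 H) (h3 : ∀ v, ∃ w, H.Adj v w)
    (h4 : IsSpectralRadius H mu) : mu ≤ lam := by
  classical
  let e := Fintype.equivFin T
  have key : ∀ (nu : ℝ) (v : T → ℝ), (adjMat H).mulVec v = nu • v ↔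
      (adjMat (H.comap e.symm)).mulVec (v ∘ e.symm) = nu • (v ∘ e.symm) := by
    intro nu v
    have : ∀ i, (adjMat (H.comap e.symm)).mulVec (v ∘ e.symm) i =
        (adjMat H).mulVec v (e.symm i) := by
      intro i
      simp only [Matrix.mulVec, dotProduct]
      exact Fintype.sum_equiv e.symm _ _ (fun _ => by simp [adjMat])
    constructor
    · intro h
      ext i
      rw [this, h]; rfl
    · intro h
      ext t
      have h' := congrFun h (e t)
      rw [this] at h'
      simpa using h'
  refine hmax (Fintype.card T) (H.comap e.symm) mu ?_ ?_ ?_ ?_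
  · rw [← h1]
    have i : H.comap e.symm ≃g H := SimpleGraph.Iso.comap e.symm H
    exact Nat.card_congr i.mapEdgeSet
  · rintro ⟨f, hf⟩
    exact h2 ⟨f.trans e.symm.toEmbedding, fun a b h => hf h⟩
  · intro v
    obtain ⟨w, hw⟩ := h3 (e.symm v)
    exact ⟨e w, by simpa using hw⟩
  · obtain ⟨⟨v, hv, hv2⟩, h5⟩ := h4
    refine ⟨⟨v ∘ e.symm, ?_, (key _ _).1 hv2⟩, ?_⟩
    · intro h
      apply hv
      ext t
      simpa using congrFun h (e t)
    · intro nu v hv hnu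
      refine h5 nu (v ∘ e) ?_ ((key _ _).2 ?_)
      · intro h
        apply hv
        ext t
        simpa using congrFun h (e.symm t)
      · have : (v ∘ e) ∘ e.symm = v := by ext; simp
        rw [this]; exact hnu

lemma lam_lower (m : ℕ) (hm57 : 57 ≤ m) (lam : ℝ)
    (hmax : ∀ (n : ℕ) (H : SimpleGraph (Fin n)) (μ : ℝ),
      H.edgeSet.ncard = m → ¬ Contains theta223 H → (∀ v, ∃ w, H.Adj v w) →
      IsSpectralRadius H μ → μ ≤ lam) :
    7 ≤ lam ∧ (m : ℝ) - 3 / 2 < lam ^ 2 - lam := by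
  obtain ⟨k, j, hk, hj, hm⟩ : ∃ k j : ℕ, 1 ≤ k ∧ j ≤ 1 ∧ m = 2 * k + 1 + j :=
    ⟨(m - 1) / 2, (m - 1) % 2, by omega, by omega, by omega⟩
  obtain ⟨mu, h1, h2, h3⟩ := hub_spec k j hk hj
  have h4 := transfer (hubGraph k j) m lam hmax mu (by rw [hub_card, hm]) (hub_free k j)
    (hub_noiso k j) h1
  have h5 : (m : ℝ) = 2 * k + 1 + j := by rw [hm]; push_cast; ring
  have h6 : (57 : ℝ) ≤ m := by exact_mod_cast hm57
  rw [← h5] at h3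
  have h7 : 7 ≤ mu := by nlinarith
  exact ⟨by linarith, by nlinarith⟩

/-- The basic counting identity at the vertex `u`. -/
lemma count_identity {V : Type*} [Fintype V] (G : SimpleGraph V) (u : V) (y : V → ℝ)
    (hu : y u = 1) (lam m : ℝ) (heig : ∀ a, ∑ b, adjMat G a b * y b = lam * y a)
    (hm : ∑ a, ∑ b, adjMat G a b = 2 * m) (U W : Finset V)
    (hU : ∀ v, v ∈ U ↔ G.Adj u v) (hpart : ∀ g : V → ℝ, ∑ v, g v = g u + ∑ v ∈ U, g v + ∑ v ∈ W, g v)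
    (hW : ∀ v ∈ W, ¬ G.Adj u v) :
    lam ^ 2 - lam - m =
      ∑ w ∈ U, (((∑ z ∈ U, adjMat G w z) - 1) * y w - (∑ z ∈ U, adjMat G w z) / 2) -
      ∑ v ∈ W, ((∑ z ∈ U, adjMat G v z) * (1 - y v) + (∑ z ∈ W, adjMat G v z) / 2) := by
  have huu : adjMat G u u = 0 := adjMat_zero (by simp)
  have hU1 : ∀ w ∈ U, adjMat G u w = 1 := fun w hw => adjMat_one ((hU w).1 hw)
  have hU1' : ∀ w ∈ U, adjMat G w u = 1 := fun w hw => by rw [adjMat_comm]; exact hU1 w hw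
  have hW0 : ∀ w ∈ W, adjMat G u w = 0 := fun w hw => adjMat_zero (hW w hw)
  have hW0' : ∀ w ∈ W, adjMat G w u = 0 := fun w hw => by rw [adjMat_comm]; exact hW0 w hw
  have e1 : lam = ∑ w ∈ U, y w := by
    have := heig u
    rw [hpart, hu, huu] at this
    rw [Finset.sum_congr rfl (fun w hw => by rw [hU1 w hw, one_mul]),
      Finset.sum_congr (s₁ := W) rfl (fun w hw => by rw [hW0 w hw, zero_mul])] at this
    simp at this
    exact this.symm
  have e2 : lam ^ 2 = #U + ∑ z ∈ U, (∑ w ∈ U, adjMat G z w) * y z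
      + ∑ v ∈ W, (∑ w ∈ U, adjMat G v w) * y v := by
    have : lam ^ 2 = ∑ w ∈ U, lam * y w := by rw [← Finset.mul_sum, ← e1]; ring
    rw [this]
    have : ∀ w ∈ U, lam * y w = 1 + ∑ z ∈ U, adjMat G w z * y z + ∑ z ∈ W, adjMat G w z * y z := by
      intro w hw
      rw [← heig w, hpart, hU1' w hw, hu, one_mul]
    rw [Finset.sum_congr rfl this, Finset.sum_add_distrib, Finset.sum_add_distrib,
      Finset.sum_comm, Finset.sum_comm (s := U) (t := W)]
    simp only [Finset.sum_mul]
    simp only [adjMat_comm G _ _, Finset.sum_const, nsmul_eq_mul, mul_one]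
  have e3 : 2 * m = 2 * #U + ∑ w ∈ U, (∑ z ∈ U, adjMat G w z)
      + 2 * ∑ v ∈ W, (∑ z ∈ U, adjMat G v z) + ∑ v ∈ W, (∑ z ∈ W, adjMat G v z) := by
    rw [← hm, hpart]
    have a1 : ∑ b, adjMat G u b = #U := by
      rw [hpart, huu, Finset.sum_congr rfl hU1, Finset.sum_congr rfl hW0]; simp
    have a2 : ∀ w ∈ U, ∑ b, adjMat G w b = 1 + ∑ z ∈ U, adjMat G w z + ∑ z ∈ W, adjMat G w z := by
      intro w hw
      rw [hpart, hU1' w hw]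
    have a3 : ∀ w ∈ W, ∑ b, adjMat G w b = ∑ z ∈ U, adjMat G w z + ∑ z ∈ W, adjMat G w z := by
      intro w hw
      rw [hpart, hW0' w hw, zero_add]
    rw [a1, Finset.sum_congr rfl a2, Finset.sum_congr rfl a3, Finset.sum_add_distrib,
      Finset.sum_add_distrib, Finset.sum_add_distrib]
    have a4 : ∑ w ∈ U, ∑ z ∈ W, adjMat G w z = ∑ v ∈ W, ∑ z ∈ U, adjMat G v z := by
      refine Finset.sum_comm.trans ?_
      exact Finset.sum_congr rfl fun a _ => Finset.sum_congr rfl fun b _ => by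
        rw [adjMat_comm]
    rw [a4]
    simp
    ring
  have r1 : ∑ w ∈ U, (((∑ z ∈ U, adjMat G w z) - 1) * y w - (∑ z ∈ U, adjMat G w z) / 2)
      = ∑ z ∈ U, (∑ w ∈ U, adjMat G z w) * y z - ∑ w ∈ U, y w
        - (∑ w ∈ U, (∑ z ∈ U, adjMat G w z)) / 2 := by
    rw [Finset.sum_div, ← Finset.sum_sub_distrib, ← Finset.sum_sub_distrib]
    exact Finset.sum_congr rfl fun _ _ => by ring
  have r2 : ∑ v ∈ W, ((∑ z ∈ U, adjMat G v z) * (1 - y v) + (∑ z ∈ W, adjMat G v z) / 2)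
      = ∑ v ∈ W, (∑ z ∈ U, adjMat G v z) - ∑ v ∈ W, (∑ w ∈ U, adjMat G v w) * y v
        + (∑ v ∈ W, (∑ z ∈ W, adjMat G v z)) / 2 := by
    rw [Finset.sum_div, ← Finset.sum_sub_distrib, ← Finset.sum_add_distrib]
    exact Finset.sum_congr rfl fun _ _ => by ring
  rw [r1, r2, e2]
  linarith

/-- Building a copy of theta from six vertices. -/
lemma theta_of {V : Type*} (G : SimpleGraph V) (a b c1 c2 d1 d2 : V)
    (h1 : G.Adj a c1) (h2 : G.Adj c1 b) (h3 : G.Adj a c2) (h4 : G.Adj c2 b)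
    (h5 : G.Adj a d1) (h6 : G.Adj d1 d2) (h7 : G.Adj d2 b)
    (n1 : a ≠ b) (n2 : a ≠ d2) (n3 : b ≠ d1) (n4 : c1 ≠ c2) (n5 : c1 ≠ d1) (n6 : c1 ≠ d2)
    (n7 : c2 ≠ d1) (n8 : c2 ≠ d2) : Contains theta223 G := by
  have := h1.ne
  have := h2.ne
  have := h3.ne
  have := h4.ne
  have := h5.ne
  have := h6.ne
  have := h7.ne
  refine ⟨⟨![a, b, c1, c2, d1, d2], ?_⟩, ?_⟩
  · intro i j hij
    fin_cases i <;> fin_cases j <;> simp_all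
  · intro i j hij
    have e1 := h1.symm
    have e2 := h2.symm
    have e3 := h3.symm
    have e4 := h4.symm
    have e5 := h5.symm
    have e6 := h6.symm
    have e7 := h7.symm
    fin_cases i <;> fin_cases j <;> simp [theta223] at hij ⊢ <;> assumption

/-- Number of neighbours of `w` inside `U`. -/
noncomputable def dIn {V : Type*} (G : SimpleGraph V) (U : Finset V) (w : V) : ℕ :=
  by classical exact #{z ∈ U | G.Adj w z}

lemma dIn_sum {V : Type*} (G : SimpleGraph V) (U : Finset V) (w : V) :
    ∑ z ∈ U, adjMat G w z = (dIn G U w : ℝ) := by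
  classical
  simp only [adjMat, Matrix.of_apply, Finset.sum_boole, dIn]

lemma exists_two_avoid {V : Type*} (G : SimpleGraph V) (U : Finset V) (w : V) (S : Finset V)
    (h : #S + 2 ≤ dIn G U w) : ∃ s t, s ≠ t ∧ s ∈ U ∧ t ∈ U ∧ G.Adj w s ∧ G.Adj w t ∧
      s ∉ S ∧ t ∉ S := by
  classical
  have h1 : 1 < #({z ∈ U | G.Adj w z} \ S) := by
    have := Finset.le_card_sdiff S {z ∈ U | G.Adj w z}
    have h2 : dIn G U w = #{z ∈ U | G.Adj w z} := by unfold dIn; congr!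
    omega
  obtain ⟨s, hs, t, ht, hst⟩ := Finset.one_lt_card.1 h1
  simp at hs ht
  exact ⟨s, t, hst, hs.1.1, ht.1.1, hs.1.2, ht.1.2, hs.2, ht.2⟩

/-- Neighbours of a vertex of large inner degree are leaves. -/
lemma nbr_leaf {V : Type*} (G : SimpleGraph V) (hfree : ¬ Contains theta223 G) (u : V)
    (U : Finset V) (hU : ∀ v, v ∈ U ↔ G.Adj u v) (w z : V) (hw : w ∈ U) (hz : z ∈ U)
    (hwz : G.Adj w z) (h4 : 4 ≤ dIn G U w) : dIn G U z ≤ 1 := by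
  classical
  by_contra hcon
  push Not at hcon
  obtain ⟨z', hz', hzz', hne⟩ : ∃ z' ∈ U, G.Adj z z' ∧ z' ≠ w := by
    unfold dIn at hcon
    obtain ⟨s, hs, t, ht, hst⟩ := Finset.one_lt_card.1 hcon
    simp at hs ht
    by_cases h : s = w
    · exact ⟨t, ht.1, ht.2, fun h' => hst (h.trans h'.symm)⟩
    · exact ⟨s, hs.1, hs.2, h⟩
  obtain ⟨s, t, hst, hsU, htU, hs, ht, hs1, ht1⟩ := exists_two_avoid G U w {z, z'} (by
    have := Finset.card_le_two (a := z) (b := z')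
    omega)
  simp at hs1 ht1
  rw [hU] at hw hz hz' hsU htU
  exact hfree (theta_of G u w s t z' z hsU hs.symm htU ht.symm hz' hzz'.symm hwz.symm
    hw.ne hz.ne hne.symm hst hs1.2 hs1.1 ht1.2 ht1.1)

/-- Outer vertices attached to a vertex of inner degree at least two. -/
lemma outer_deg {V : Type*} (G : SimpleGraph V) (hfree : ¬ Contains theta223 G) (u : V)
    (U : Finset V) (hU : ∀ v, v ∈ U ↔ G.Adj u v) (w v : V) (hw : w ∈ U) (hv : v ∉ U)
    (hvu : v ≠ u) (hwv : G.Adj w v) (h2 : 2 ≤ dIn G U w) : 1 ≤ dIn G U v ∧ dIn G U v ≤ 3 := by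
  classical
  constructor
  · unfold dIn
    apply Finset.card_pos.2
    exact ⟨w, by simp [hw, hwv.symm]⟩
  by_cases hall : ∃ w' ∈ U, G.Adj v w' ∧ w' ≠ w ∧ (G.Adj w w' → 3 ≤ dIn G U w)
  · exfalso
    obtain ⟨w', hw', hvw', hne, himp⟩ := hall
    obtain ⟨s, t, hst, hsU, htU, hs, ht, hs1, ht1⟩ : ∃ s t, s ≠ t ∧ s ∈ U ∧ t ∈ U ∧
        G.Adj w s ∧ G.Adj w t ∧ s ≠ w' ∧ t ≠ w' := by
      by_cases hadj : G.Adj w w'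
      · have := exists_two_avoid G U w {w'} (by simpa using himp hadj)
        simpa using this
      · obtain ⟨s, t, h1, h2, h3, h4, h5, -, -⟩ := exists_two_avoid G U w ∅ (by simpa using h2)
        exact ⟨s, t, h1, h2, h3, h4, h5, fun h => hadj (h ▸ h4), fun h => hadj (h ▸ h5)⟩
    have hsv : s ≠ v := fun h => hv (h ▸ hsU)
    have htv : t ≠ v := fun h => hv (h ▸ htU)
    rw [hU] at hw hw' hsU htU
    exact hfree (theta_of G u w s t w' v hsU hs.symm htU ht.symm hw' hvw'.symm hwv.symm
      hw.ne hvu.symm hne.symm hst hs1 hsv ht1 htv)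
  · push Not at hall
    have hsub : {z ∈ U | G.Adj v z} ⊆ insert w (if 3 ≤ dIn G U w then ∅ else {z ∈ U | G.Adj w z}) := by
      intro z hz
      simp at hz
      by_cases hzw : z = w
      · simp [hzw]
      · obtain ⟨ha, hb⟩ := hall z hz.1 hz.2 hzw
        rw [if_neg (by omega)]
        simp [hz.1, ha]
    have hc := Finset.card_le_card hsub
    have hi := Finset.card_insert_le w (if 3 ≤ dIn G U w then ∅ else {z ∈ U | G.Adj w z})
    have e1 : dIn G U v = #{z ∈ U | G.Adj v z} := by unfold dIn; congr!
    have e2 : dIn G U w = #{z ∈ U | G.Adj w z} := by unfold dIn; congr!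
    split_ifs at hi hc with h3
    · simp at hi hc; omega
    · omega

/-- Discharging weight on ordered inner edges. -/
noncomputable def phi {V : Type*} (G : SimpleGraph V) (U : Finset V) (w z : V) : ℝ :=
  if 4 ≤ dIn G U w then 1 else if 4 ≤ dIn G U z then 0 else 1 / 2

/-- Charge sent by outer vertices. -/
noncomputable def chi {V : Type*} (G : SimpleGraph V) (U : Finset V) (v : V) : ℝ :=
  if 1 ≤ dIn G U v ∧ dIn G U v ≤ 3 then 1 / 2 else 0

lemma phi_nonneg {V : Type*} (G : SimpleGraph V) (U : Finset V) (w z : V) : 0 ≤ phi G U w z := by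
  unfold phi; split_ifs <;> norm_num

lemma chi_nonneg {V : Type*} (G : SimpleGraph V) (U : Finset V) (v : V) : 0 ≤ chi G U v := by
  unfold chi; split_ifs <;> norm_num

lemma main_aux {V : Type*} [Fintype V] (G : SimpleGraph V) (hfree : ¬ Contains theta223 G)
    (u : V) (y : V → ℝ) (hy : ∀ v, 0 < y v) (hy1 : ∀ v, y v ≤ 1)
    (hu : y u = 1) (lam m : ℝ) (heig : ∀ a, ∑ b, adjMat G a b * y b = lam * y a)
    (hm : ∑ a, ∑ b, adjMat G a b = 2 * m) (U W : Finset V)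
    (hU : ∀ v, v ∈ U ↔ G.Adj u v)
    (hpart : ∀ g : V → ℝ, ∑ v, g v = g u + ∑ v ∈ U, g v + ∑ v ∈ W, g v)
    (hW : ∀ v ∈ W, ¬ G.Adj u v ∧ v ≠ u) (hlam : 7 ≤ lam) (hgap : m - 3 / 2 < lam ^ 2 - lam)
    (p0 p1 p2 : V) (h0 : p0 ∈ U) (h1 : p1 ∈ U) (h2 : p2 ∈ U) (h01 : p0 ≠ p1) (h02 : p0 ≠ p2)
    (h12 : p1 ≠ p2) (d0 : dIn G U p0 = 1) (d1 : dIn G U p1 = 2) (d2 : dIn G U p2 = 1)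
    (n0 : ∀ z ∈ U, G.Adj p0 z → dIn G U z ≤ 3) (n2 : ∀ z ∈ U, G.Adj p2 z → dIn G U z ≤ 3) :
    False := by
  classical
  have hid := count_identity G u y hu lam m heig hm U W hU hpart (fun v hv => (hW v hv).1)
  have hWU : ∀ v ∈ W, v ∉ U := fun v hv h => (hW v hv).1 ((hU v).1 h)
  have hU1' : ∀ w ∈ U, adjMat G w u = 1 := fun w hw => adjMat_one ((hU w).1 hw).symm
  have hW0' : ∀ w ∈ W, adjMat G w u = 0 :=
    fun w hw => adjMat_zero (fun h => (hW w hw).1 h.symm)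
  have hbound : ∀ (S : Finset V) (w : V), ∑ z ∈ S, adjMat G w z * y z ≤ ∑ z ∈ S, adjMat G w z := by
    intro S w
    apply Finset.sum_le_sum
    intro z _
    exact mul_le_of_le_one_right (adjMat_nonneg G w z) (hy1 z)
  -- cost of outer vertices
  have hcost : ∀ v ∈ W, (∑ z ∈ U, adjMat G v z) * chi G U v ≤
      (∑ z ∈ U, adjMat G v z) * (1 - y v) + (∑ z ∈ W, adjMat G v z) / 2 := by
    intro v hv
    have e := heig v
    rw [hpart, hW0' v hv] at e
    have b1 := hbound U v
    have b2 := hbound W v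
    have hdW : 0 ≤ ∑ z ∈ W, adjMat G v z := Finset.sum_nonneg fun z _ => adjMat_nonneg G v z
    rw [dIn_sum] at b1 ⊢
    have hp := hy v
    have hp1 := hy1 v
    have hl : 7 * y v ≤ lam * y v := mul_le_mul_of_nonneg_right hlam hp.le
    unfold chi
    split_ifs with hc
    · have c1 : (1 : ℝ) ≤ dIn G U v := by exact_mod_cast hc.1
      have c3 : (dIn G U v : ℝ) ≤ 3 := by exact_mod_cast hc.2
      by_cases hh : y v ≤ 1 / 2
      · nlinarith
      · nlinarith
    · have : (0 : ℝ) ≤ dIn G U v := by positivity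
      nlinarith
  have hs1 : ∑ w ∈ U, ∑ v ∈ W, adjMat G w v * chi G U v ≤
      ∑ v ∈ W, ((∑ z ∈ U, adjMat G v z) * (1 - y v) + (∑ z ∈ W, adjMat G v z) / 2) := by
    refine le_trans (le_of_eq ?_) (Finset.sum_le_sum hcost)
    refine Finset.sum_comm.trans ?_
    refine Finset.sum_congr rfl fun v _ => ?_
    rw [Finset.sum_mul]
    exact Finset.sum_congr rfl fun w _ => by rw [adjMat_comm]
  -- inner edges
  have hs2 : ∑ w ∈ U, ∑ z ∈ U, adjMat G w z * phi G U w z ≤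
      ∑ w ∈ U, (∑ z ∈ U, adjMat G w z) / 2 := by
    have hsym : ∑ w ∈ U, ∑ z ∈ U, adjMat G w z * phi G U w z =
        ∑ w ∈ U, ∑ z ∈ U, adjMat G w z * phi G U z w := by
      refine Finset.sum_comm.trans ?_
      exact Finset.sum_congr rfl fun a _ => Finset.sum_congr rfl fun b _ => by
        rw [adjMat_comm]
    have h2 : ∑ w ∈ U, ∑ z ∈ U, adjMat G w z * phi G U w z +
        ∑ w ∈ U, ∑ z ∈ U, adjMat G w z * phi G U z w ≤ ∑ w ∈ U, ∑ z ∈ U, adjMat G w z := by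
      rw [← Finset.sum_add_distrib]
      refine Finset.sum_le_sum fun w hw => ?_
      rw [← Finset.sum_add_distrib]
      refine Finset.sum_le_sum fun z hz => ?_
      by_cases h : G.Adj w z
      · rw [adjMat_one h]
        have := nbr_leaf G hfree u U hU w z hw hz h
        unfold phi
        split_ifs <;> first | omega | norm_num
      · rw [adjMat_zero h]; simp
    rw [← Finset.sum_div]
    linarith
  set F : V → ℝ := fun w => ((∑ z ∈ U, adjMat G w z) - 1) * y w
    - ∑ z ∈ U, adjMat G w z * phi G U w z - ∑ v ∈ W, adjMat G w v * chi G U v with hF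
  have htot : -(3 / 2) < ∑ w ∈ U, F w := by
    have : ∑ w ∈ U, F w = ∑ w ∈ U, ((∑ z ∈ U, adjMat G w z) - 1) * y w
        - ∑ w ∈ U, ∑ z ∈ U, adjMat G w z * phi G U w z
        - ∑ w ∈ U, ∑ v ∈ W, adjMat G w v * chi G U v := by
      rw [← Finset.sum_sub_distrib, ← Finset.sum_sub_distrib]
    rw [this]
    rw [Finset.sum_sub_distrib] at hid
    linarith
  have hchi0 : ∀ w, 0 ≤ ∑ v ∈ W, adjMat G w v * chi G U v := fun w =>
    Finset.sum_nonneg fun v _ => mul_nonneg (adjMat_nonneg _ _ _) (chi_nonneg _ _ _)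
  have hphi0 : ∀ w, 0 ≤ ∑ z ∈ U, adjMat G w z * phi G U w z := fun w =>
    Finset.sum_nonneg fun v _ => mul_nonneg (adjMat_nonneg _ _ _) (phi_nonneg _ _ _ _)
  -- value of the phi sum
  have hphiconst : ∀ w (t : ℝ), (∀ z ∈ U, G.Adj w z → phi G U w z = t) →
      ∑ z ∈ U, adjMat G w z * phi G U w z = dIn G U w * t := by
    intro w t h
    rw [← dIn_sum, Finset.sum_mul]
    refine Finset.sum_congr rfl fun z hz => ?_
    by_cases hh : G.Adj w z
    · rw [h z hz hh]
    · rw [adjMat_zero hh]; simp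
  have hphihalf : ∀ w ∈ U, 2 ≤ dIn G U w → dIn G U w ≤ 3 →
      ∑ z ∈ U, adjMat G w z * phi G U w z = dIn G U w * (1 / 2) := by
    intro w hw ha hb
    apply hphiconst
    intro z hz hwz
    have := nbr_leaf G hfree u U hU z w hz hw hwz.symm
    unfold phi
    rw [if_neg (by omega), if_neg (by intro h; have := this h; omega)]
  -- large entries force outer neighbours
  have hchihalf : ∀ w ∈ U, 2 ≤ dIn G U w → (dIn G U w : ℝ) + 1 < 7 * y w →
      1 / 2 ≤ ∑ v ∈ W, adjMat G w v * chi G U v := by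
    intro w hw ha hb
    obtain ⟨v, hv, hwv⟩ : ∃ v ∈ W, G.Adj w v := by
      by_contra hcon
      push Not at hcon
      have e := heig w
      rw [hpart, hU1' w hw, hu, Finset.sum_congr (s₁ := W) rfl
        (fun z hz => by rw [adjMat_zero (hcon z hz), zero_mul])] at e
      have b1 := hbound U w
      rw [dIn_sum] at b1
      have hl : 7 * y w ≤ lam * y w := mul_le_mul_of_nonneg_right hlam (hy w).le
      simp at e
      linarith
    have hval : adjMat G w v * chi G U v = 1 / 2 := by
      rw [adjMat_one hwv]
      unfold chi
      rw [if_pos (outer_deg G hfree u U hU w v hw (hWU v hv) (hW v hv).2 hwv ha)]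
      norm_num
    rw [← hval]
    exact Finset.single_le_sum (f := fun v => adjMat G w v * chi G U v)
      (fun v _ => mul_nonneg (adjMat_nonneg _ _ _) (chi_nonneg _ _ _)) hv
  have hFle : ∀ w ∈ U, F w ≤ 0 := by
    intro w hw
    have a1 := hchi0 w
    have a2 := hphi0 w
    have a3 := hy w
    have a4 := hy1 w
    simp only [hF]
    rw [dIn_sum]
    rcases Nat.lt_or_ge (dIn G U w) 2 with h | h
    · have : (dIn G U w : ℝ) ≤ 1 := by exact_mod_cast Nat.lt_succ_iff.1 h
      nlinarith
    rcases Nat.lt_or_ge (dIn G U w) 4 with h' | h'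
    · rw [hphihalf w hw h (by omega)]
      have hc := hchihalf w hw h
      obtain hd | hd : dIn G U w = 2 ∨ dIn G U w = 3 := by omega
      · rw [hd]; push_cast; linarith
      · rw [hd] at hc ⊢
        push_cast at hc ⊢
        by_cases hyw : y w ≤ 3 / 4
        · linarith
        · have := hc (by linarith)
          linarith
    · rw [hphiconst w 1 (fun z _ _ => by unfold phi; rw [if_pos h'])]
      have : (4 : ℝ) ≤ dIn G U w := by exact_mod_cast h'
      nlinarith
  have hleaf : ∀ p ∈ U, dIn G U p = 1 → (∀ z ∈ U, G.Adj p z → dIn G U z ≤ 3) →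
      F p ≤ -(1 / 2) := by
    intro p hp hd hn
    have a1 := hchi0 p
    simp only [hF]
    rw [dIn_sum, hphiconst p (1 / 2) (fun z hz hpz => by
      unfold phi
      have := hn z hz hpz
      rw [if_neg (by omega), if_neg (by omega)]), hd]
    push_cast
    linarith
  have f0 := hleaf p0 h0 d0 n0
  have f2 := hleaf p2 h2 d2 n2
  have f1 : F p1 ≤ -(1 / 2) := by
    have a1 := hchi0 p1
    have a4 := hy1 p1
    have hc := hchihalf p1 h1 (by omega)
    simp only [hF]
    rw [dIn_sum, hphihalf p1 h1 (by omega) (by omega)]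
    rw [d1] at hc ⊢
    push_cast at hc ⊢
    by_cases hyw : y p1 ≤ 1 / 2
    · linarith
    · have := hc (by linarith)
      linarith
  have hsub : ({p0, p1, p2} : Finset V) ⊆ U := by
    intro z hz
    simp at hz
    rcases hz with rfl | rfl | rfl <;> assumption
  have hle : ∑ w ∈ U, F w ≤ ∑ w ∈ ({p0, p1, p2} : Finset V), F w := by
    rw [← Finset.sum_sdiff hsub]
    have : ∑ w ∈ U \ {p0, p1, p2}, F w ≤ 0 :=
      Finset.sum_nonpos fun w hw => hFle w (Finset.mem_sdiff.1 hw).1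
    linarith
  rw [Finset.sum_insert (by simp [h01, h02]), Finset.sum_pair h12] at hle
  linarith

end Helpers

theorem stmt11 {V : Type*} [Fintype V] (G : SimpleGraph V) (m : ℕ)
    (hm : G.edgeSet.ncard = m) (hm57 : 57 ≤ m)
    (hfree : ¬ Contains theta223 G)
    (hiso : ∀ v : V, ∃ w, G.Adj v w)
    (lam : ℝ) (hlam : IsSpectralRadius G lam)
    (hmax : ∀ (n : ℕ) (H : SimpleGraph (Fin n)) (μ : ℝ),
      H.edgeSet.ncard = m → ¬ Contains theta223 H → (∀ v, ∃ w, H.Adj v w) →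
      IsSpectralRadius H μ → μ ≤ lam)
    (x : V → ℝ) (hx : ∀ v, 0 < x v)
    (heig : (adjMat G).mulVec x = lam • x)
    (ustar : V) (hustar : ∀ v, x v ≤ x ustar) :
    ∀ k, 4 ≤ k →
      ∀ c : (G.induce (G.neighborSet ustar)).ConnectedComponent,
        ¬ Nonempty (((G.induce (G.neighborSet ustar)).induce c.supp) ≃g
          SimpleGraph.pathGraph k) := by

  classical
  rintro k hk c ⟨ψ⟩
  obtain ⟨hl7, hgap⟩ := lam_lower m hm57 lam hmax
  have hxu := hx ustar
  set U : Finset V := Finset.univ.filter (fun v => G.Adj ustar v) with hUdef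
  set W : Finset V := Finset.univ.filter (fun v => ¬ G.Adj ustar v ∧ v ≠ ustar) with hWdef
  have hU : ∀ v, v ∈ U ↔ G.Adj ustar v := by simp [hUdef]
  have hW : ∀ v ∈ W, ¬ G.Adj ustar v ∧ v ≠ ustar := by simp [hWdef]
  have hpart : ∀ g : V → ℝ,
      ∑ v, g v = g ustar + ∑ v ∈ U, g v + ∑ v ∈ W, g v := by
    intro g
    rw [← Finset.sum_filter_add_sum_filter_not Finset.univ (fun v => G.Adj ustar v) g]
    have : Finset.univ.filter (fun v => ¬ G.Adj ustar v) = insert ustar W := by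
      ext v
      simp only [Finset.mem_filter, Finset.mem_univ, true_and, Finset.mem_insert, hWdef]
      by_cases hv : v = ustar
      · simp [hv]
      · simp [hv]
    rw [this, Finset.sum_insert (by simp [hWdef])]
    ring
  -- the vertices of the path
  let p : Fin k → V := fun i => ((ψ.symm i).1).1
  have hpinj : Function.Injective p := fun i j h =>
    ψ.symm.injective (Subtype.ext (Subtype.ext h))
  have hpU : ∀ i, p i ∈ U := fun i => (hU _).2 ((ψ.symm i).1).2
  have hpadj : ∀ i j, (SimpleGraph.pathGraph k).Adj i j ↔ G.Adj (p i) (p j) := by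
    intro i j
    rw [← ψ.symm.map_adj_iff]
    rfl
  have hpn : ∀ i, ∀ z ∈ U, G.Adj (p i) z → ∃ j, z = p j := by
    intro i z hz hiz
    have hzn : z ∈ G.neighborSet ustar := (hU z).1 hz
    have hadj : (G.induce (G.neighborSet ustar)).Adj (ψ.symm i).1 ⟨z, hzn⟩ := hiz
    have hmem : (⟨z, hzn⟩ : G.neighborSet ustar) ∈ c.supp := by
      have h1 := (ψ.symm i).2
      rw [SimpleGraph.ConnectedComponent.mem_supp_iff] at h1 ⊢
      rw [← h1]
      exact (SimpleGraph.ConnectedComponent.sound hadj.reachable).symm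
    exact ⟨ψ ⟨⟨z, hzn⟩, hmem⟩, by
      show z = (ψ.symm (ψ ⟨⟨z, hzn⟩, hmem⟩)).1.1
      rw [RelIso.symm_apply_apply]⟩
  have hdeg : ∀ i, dIn G U (p i) =
      (Finset.univ.filter (fun j : Fin k => i.val + 1 = j.val ∨ j.val + 1 = i.val)).card := by
    intro i
    rw [← Finset.card_image_of_injective _ hpinj]
    unfold dIn
    congr 1
    ext z
    simp only [Finset.mem_filter, Finset.mem_image, Finset.mem_univ, true_and]
    constructor
    · rintro ⟨hz, hiz⟩
      obtain ⟨j, rfl⟩ := hpn i z hz hiz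
      exact ⟨j, by rw [← hpadj, SimpleGraph.pathGraph_adj] at hiz; exact hiz, rfl⟩
    · rintro ⟨j, hj, rfl⟩
      exact ⟨hpU j, by rw [← hpadj, SimpleGraph.pathGraph_adj]; exact hj⟩
  have hdeg2 : ∀ i, dIn G U (p i) ≤ 2 := by
    intro i
    rw [hdeg]
    by_contra hcon
    push Not at hcon
    obtain ⟨a, b, d, ha, hb, hd, hab, had, hbd⟩ := Finset.two_lt_card_iff.1 hcon
    simp at ha hb hd
    rw [ne_eq, Fin.ext_iff] at hab had hbd
    omega
  have hn : ∀ i, ∀ z ∈ U, G.Adj (p i) z → dIn G U z ≤ 3 := by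
    intro i z hz hiz
    obtain ⟨j, rfl⟩ := hpn i z hz hiz
    have := hdeg2 j
    omega
  have d0 : dIn G U (p ⟨0, by omega⟩) = 1 := by
    rw [hdeg, Finset.card_eq_one]
    refine ⟨⟨1, by omega⟩, ?_⟩
    ext j
    simp [Fin.ext_iff]
    omega
  have d1 : dIn G U (p ⟨1, by omega⟩) = 2 := by
    rw [hdeg, Finset.card_eq_two]
    refine ⟨⟨0, by omega⟩, ⟨2, by omega⟩, by simp, ?_⟩
    ext j
    simp [Fin.ext_iff]
    omega
  have d2 : dIn G U (p ⟨k - 1, by omega⟩) = 1 := by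
    rw [hdeg, Finset.card_eq_one]
    refine ⟨⟨k - 2, by omega⟩, ?_⟩
    ext j
    have := j.2
    simp [Fin.ext_iff]
    omega
  refine main_aux G hfree ustar (fun v => x v / x ustar) (fun v => div_pos (hx v) hxu)
    (fun v => (div_le_one hxu).2 (hustar v)) (div_self hxu.ne') lam m ?_ ?_ U W hU hpart hW hl7
    hgap (p ⟨0, by omega⟩) (p ⟨1, by omega⟩) (p ⟨k - 1, by omega⟩) (hpU _) (hpU _) (hpU _)
    ?_ ?_ ?_ d0 d1 d2 (hn _) (hn _)
  · intro a
    have := congrFun heig a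
    simp only [Matrix.mulVec, dotProduct, Pi.smul_apply, smul_eq_mul] at this
    rw [← mul_div_assoc, ← this, Finset.sum_div]
    exact Finset.sum_congr rfl fun b _ => by rw [mul_div_assoc]
  · rw [adjMat_sum, hm]
  · intro h; have := hpinj h; simp at this
  · intro h; have := Fin.ext_iff.1 (hpinj h); simp at this; omega
  · intro h; have := Fin.ext_iff.1 (hpinj h); simp at this; omega
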